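/- arXiv:q-alg/9509013 — 2 statements merged into one kernel-verified Lean document; each statement's English description precedes it below -/
import Mathlib

section
/- Let 0 < q < 1 be real, let ν be a real number such that none of ν, ν−1, −ν, −ν+1 is a negative integer, and let z > 0 be real. Then, with g(z) = z^ν I^{(2)}_ν((1−q²)z; q²) and h(z) = z^ν I^{(2)}_{−ν}((1−q²)z; q²): (2/((1+q)z)) ∂_q g(z) = q^{−ν+1} z^{ν−1} I^{(2)}_{ν−1}((1−q²)qz; q²) and (2/((1+q)z)) ∂_q h(z) = q^{−ν+1} z^{ν−1} I^{(2)}_{−ν+1}((1−q²)qz; q²). -/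
/-- The finite q-Pochhammer symbol `(a;q)_n = ∏_{j=0}^{n-1} (1 - a q^j)` (real version). -/
noncomputable def qPochR (a q : ℝ) (n : ℕ) : ℝ := ∏ j ∈ Finset.range n, (1 - a * q ^ j)

/-- The infinite q-Pochhammer symbol `(a;q)_∞ = ∏_{j=0}^{∞} (1 - a q^j)` (real version). -/
noncomputable def qPochInfR (a q : ℝ) : ℝ := ∏' j : ℕ, (1 - a * q ^ j)

/-- The q²-Gamma function `Γ_{q²}(s) = ((q²;q²)_∞ / (q^{2s};q²)_∞) (1-q²)^{1-s}`,
with `q^{2s} = exp(2s ln q)`. -/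
noncomputable def qGamma2 (q s : ℝ) : ℝ :=
  (qPochInfR (q ^ 2) (q ^ 2) / qPochInfR (Real.exp (2 * s * Real.log q)) (q ^ 2)) *
    (1 - q ^ 2) ^ (1 - s)

/-- The first modified q-Bessel function:
`I¹ q ν z = I^{(1)}_ν((1-q²)z; q²) = ∑_{k=0}^∞ (1-q²)^k (z/2)^{ν+2k} / ((q²;q²)_k Γ_{q²}(ν+k+1))`. -/
noncomputable def I1 (q ν z : ℝ) : ℝ :=
  ∑' k : ℕ, (1 - q ^ 2) ^ k * (z / 2) ^ (ν + 2 * (k : ℝ)) /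
    (qPochR (q ^ 2) (q ^ 2) k * qGamma2 q (ν + k + 1))

/-- The second modified q-Bessel function:
`I² q ν z = I^{(2)}_ν((1-q²)z; q²)
  = ∑_{k=0}^∞ q^{2k(ν+k)} (1-q²)^k (z/2)^{ν+2k} / ((q²;q²)_k Γ_{q²}(ν+k+1))`. -/
noncomputable def I2 (q ν z : ℝ) : ℝ :=
  ∑' k : ℕ, q ^ (2 * (k : ℝ) * (ν + k)) * (1 - q ^ 2) ^ k * (z / 2) ^ (ν + 2 * (k : ℝ)) /
    (qPochR (q ^ 2) (q ^ 2) k * qGamma2 q (ν + k + 1))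

/-- The q-derivative `∂_q f(z) = (f(z) - f(qz)) / ((1-q)z)`. -/
noncomputable def qDeriv (q : ℝ) (f : ℝ → ℝ) (z : ℝ) : ℝ := (f z - f (q * z)) / ((1 - q) * z)

lemma aux_poch_step (a q : ℝ) (hq0 : 0 < q) (hq1 : q < 1) :
    qPochInfR a q = (1 - a) * qPochInfR (a * q) q := by
  unfold qPochInfR
  have hm : Multipliable (fun j : ℕ => (1 - a * q * q ^ j)) := by
    have : Multipliable (fun j : ℕ => (1 + (-(a * q)) * q ^ j)) := by
      apply multipliable_one_add_of_summable
      apply Summable.norm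
      exact (summable_geometric_of_lt_one hq0.le hq1).mul_left _
    refine this.congr ?_
    intro j; ring
  have hm' : Multipliable (fun j : ℕ => (1 - a * q ^ (j + 1))) := by
    refine hm.congr ?_
    intro j; ring
  have h := tprod_eq_zero_mul' (f := fun j : ℕ => (1 - a * q ^ j)) hm'
  have h2 : ∏' j : ℕ, (1 - a * q ^ (j + 1)) = ∏' j : ℕ, (1 - a * q * q ^ j) := by
    apply tprod_congr
    intro j
    rw [pow_succ']
    ring
  rw [h, h2, pow_zero, mul_one]

lemma aux_gamma_step (q s : ℝ) (hq0 : 0 < q) (hq1 : q < 1) (hs : s ≠ 0) :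
    1 - q ^ (2 * s) ≠ 0 ∧
    qGamma2 q (s + 1) = (1 - q ^ (2 * s)) / (1 - q ^ 2) * qGamma2 q s := by
  have hne : 1 - q ^ (2 * s) ≠ 0 := by
    intro h
    have h1 : q ^ (2 * s) = 1 := by linarith
    have h2 := congrArg Real.log h1
    rw [Real.log_rpow hq0, Real.log_one] at h2
    have h3 := Real.log_neg hq0 hq1
    rcases mul_eq_zero.1 h2 with h | h
    · apply hs; linarith
    · linarith
  refine ⟨hne, ?_⟩
  have hq2 : q ^ 2 < 1 := by nlinarith
  have hp : 0 < 1 - q ^ 2 := by linarith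
  unfold qGamma2
  have e1 : Real.exp (2 * s * Real.log q) = q ^ (2 * s) := by
    rw [Real.rpow_def_of_pos hq0]; ring_nf
  have e2 : Real.exp (2 * (s + 1) * Real.log q) = q ^ (2 * s) * q ^ 2 := by
    have : (2 * (s + 1) * Real.log q) = Real.log q * (2 * s + 2) := by ring
    rw [this, ← Real.rpow_def_of_pos hq0, Real.rpow_add hq0]
    norm_num
  rw [e1, e2, aux_poch_step (q ^ (2 * s)) (q ^ 2) (by positivity) hq2]
  have e3 : (1 - q ^ 2) ^ (1 - s) = (1 - q ^ 2) ^ (1 - (s + 1)) * (1 - q ^ 2) := by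
    conv_rhs => rw [← Real.rpow_add_one hp.ne']
    congr 1; ring
  rw [e3, div_mul_eq_div_div_swap]
  have hp' := hp.ne'
  generalize (1 - q ^ 2) ^ (1 - (s + 1)) = A
  generalize qPochInfR (q ^ 2) (q ^ 2) / qPochInfR (q ^ (2 * s) * q ^ 2) (q ^ 2) = B
  field_simp

/-- general term of the series -/
noncomputable def auxT (q ν z : ℝ) (k : ℕ) : ℝ :=
  q ^ (2 * (k : ℝ) * (ν + k)) * (1 - q ^ 2) ^ k * (z / 2) ^ (ν + 2 * (k : ℝ)) /
    (qPochR (q ^ 2) (q ^ 2) k * qGamma2 q (ν + k + 1))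

lemma aux_poch_succ (q : ℝ) (k : ℕ) :
    qPochR (q ^ 2) (q ^ 2) (k + 1) = qPochR (q ^ 2) (q ^ 2) k * (1 - q ^ 2 * (q ^ 2) ^ k) := by
  unfold qPochR; rw [Finset.prod_range_succ]

lemma aux_rec (q ν z : ℝ) (hq0 : 0 < q) (hq1 : q < 1) (hz : 0 < z)
    (hν : ∀ k : ℕ, ν + k + 1 ≠ 0) (k : ℕ) :
    auxT q ν z (k + 1) = (q ^ (2 * (1 + ν)) * (1 - q ^ 2) ^ 2 * (z / 2) ^ 2 * (q ^ 4) ^ k /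
      ((1 - q ^ 2 * (q ^ 2) ^ k) * (1 - q ^ (2 * (1 + ν)) * (q ^ 2) ^ k))) * auxT q ν z k := by
  unfold auxT
  obtain ⟨g1, g2⟩ := aux_gamma_step q (ν + k + 1) hq0 hq1 (hν k)
  have e0 : q ^ (2 * (ν + k + 1)) = q ^ (2 * (1 + ν)) * (q ^ 2) ^ k := by
    rw [show 2 * (ν + k + 1) = 2 * (1 + ν) + ((2 * k : ℕ) : ℝ) by push_cast; ring,
      Real.rpow_add hq0, Real.rpow_natCast, pow_mul]
  rw [e0] at g1 g2
  have e1 : q ^ (2 * ((k + 1 : ℕ) : ℝ) * (ν + (k + 1 : ℕ))) =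
      q ^ (2 * (k : ℝ) * (ν + k)) * (q ^ (2 * (1 + ν)) * (q ^ 4) ^ k) := by
    rw [show 2 * ((k + 1 : ℕ) : ℝ) * (ν + (k + 1 : ℕ)) =
      2 * (k : ℝ) * (ν + k) + (2 * (1 + ν) + ((4 * k : ℕ) : ℝ)) by push_cast; ring,
      Real.rpow_add hq0, Real.rpow_add hq0, Real.rpow_natCast, pow_mul]
  have e2 : (z / 2) ^ (ν + 2 * ((k + 1 : ℕ) : ℝ)) = (z / 2) ^ (ν + 2 * (k : ℝ)) * (z / 2) ^ 2 := by
    rw [show ν + 2 * ((k + 1 : ℕ) : ℝ) = ν + 2 * (k : ℝ) + ((2 : ℕ) : ℝ) by push_cast; ring,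
      Real.rpow_add (by positivity), Real.rpow_natCast]
  have e3 : ν + ((k + 1 : ℕ) : ℝ) + 1 = ν + k + 1 + 1 := by push_cast; ring
  rw [e1, e2, e3, g2, aux_poch_succ]
  have hp : 1 - q ^ 2 ≠ 0 := by nlinarith
  generalize q ^ (2 * (1 + ν)) = A at *
  generalize (z / 2) ^ (ν + 2 * (k : ℝ)) = B
  generalize q ^ (2 * (k : ℝ) * (ν + k)) = C
  generalize qGamma2 q (ν + k + 1) = D
  generalize qPochR (q ^ 2) (q ^ 2) k = E
  generalize (1 - A * (q ^ 2) ^ k) = F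
  generalize (1 - q ^ 2 * (q ^ 2) ^ k) = G
  rw [pow_succ]
  generalize 1 - q ^ 2 = H at *
  simp only [div_eq_mul_inv, mul_inv, inv_inv]
  ring

lemma aux_summable (q ν z : ℝ) (hq0 : 0 < q) (hq1 : q < 1) (hz : 0 < z)
    (hν : ∀ k : ℕ, ν + k + 1 ≠ 0) : Summable (auxT q ν z) := by
  have ht : Filter.Tendsto (fun k : ℕ => q ^ (2 * (1 + ν)) * (1 - q ^ 2) ^ 2 * (z / 2) ^ 2 * (q ^ 4) ^ k /
      ((1 - q ^ 2 * (q ^ 2) ^ k) * (1 - q ^ (2 * (1 + ν)) * (q ^ 2) ^ k))) Filter.atTop (nhds 0) := by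
    have t4 : Filter.Tendsto (fun k : ℕ => (q ^ 4) ^ k) Filter.atTop (nhds 0) :=
      tendsto_pow_atTop_nhds_zero_of_lt_one (by positivity) (pow_lt_one₀ hq0.le hq1 (by norm_num))
    have t2 : Filter.Tendsto (fun k : ℕ => (q ^ 2) ^ k) Filter.atTop (nhds 0) :=
      tendsto_pow_atTop_nhds_zero_of_lt_one (by positivity) (pow_lt_one₀ hq0.le hq1 (by norm_num))
    have := (t4.const_mul (q ^ (2 * (1 + ν)) * (1 - q ^ 2) ^ 2 * (z / 2) ^ 2)).div
      (((t2.const_mul (q ^ 2)).const_sub 1).mul ((t2.const_mul (q ^ (2 * (1 + ν)))).const_sub 1))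
      (by simp)
    simp only [mul_zero, zero_div] at this
    exact this
  have ht' := ht.norm
  rw [norm_zero] at ht'
  refine summable_of_ratio_norm_eventually_le (r := 1 / 2) (by norm_num) ?_
  filter_upwards [ht'.eventually (gt_mem_nhds (show (0 : ℝ) < 1 / 2 by norm_num))] with k hk
  rw [aux_rec q ν z hq0 hq1 hz hν k, norm_mul]
  exact mul_le_mul_of_nonneg_right hk.le (norm_nonneg _)

lemma aux_I2 (q ν z : ℝ) : I2 q ν z = ∑' k, auxT q ν z k := rfl

lemma aux_lhs (q ν μ z : ℝ) (hq0 : 0 < q) (hq1 : q < 1) (hz : 0 < z)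
    (hμ : ∀ k : ℕ, μ + k + 1 ≠ 0) :
    Summable (fun k : ℕ => 2 / ((1 - q ^ 2) * z ^ 2) * (z ^ ν * (1 - q ^ (ν + μ + 2 * k)) * auxT q μ z k)) ∧
    (2 / ((1 + q) * z)) * qDeriv q (fun t => t ^ ν * I2 q μ t) z =
    ∑' k : ℕ, 2 / ((1 - q ^ 2) * z ^ 2) * (z ^ ν * (1 - q ^ (ν + μ + 2 * k)) * auxT q μ z k) := by
  have s1 := (aux_summable q μ z hq0 hq1 hz hμ).mul_left (z ^ ν)
  have s2 := (aux_summable q μ (q * z) hq0 hq1 (by positivity) hμ).mul_left ((q * z) ^ ν)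
  have key : ∀ k : ℕ, z ^ ν * auxT q μ z k - (q * z) ^ ν * auxT q μ (q * z) k =
      z ^ ν * (1 - q ^ (ν + μ + 2 * k)) * auxT q μ z k := by
    intro k
    unfold auxT
    rw [mul_div_assoc q z 2, Real.mul_rpow hq0.le hz.le,
      Real.mul_rpow hq0.le (by positivity : 0 ≤ z / 2), add_assoc ν, Real.rpow_add hq0 ν]
    ring
  have s3 := s1.sub s2
  simp only [key] at s3
  refine ⟨s3.mul_left _, ?_⟩
  rw [tsum_mul_left, ← tsum_congr key, s1.tsum_sub s2, tsum_mul_left, tsum_mul_left]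
  unfold qDeriv
  simp only [aux_I2]
  have : 1 - q ≠ 0 := by linarith
  have h' : 1 + q ≠ 0 := by linarith
  rw [show 1 - q ^ 2 = (1 - q) * (1 + q) by ring]
  field_simp

/-- The q-derivative relations for `I^{(2)}`:
`(2/((1+q)z)) ∂_q [z^ν I^{(2)}_ν((1-q²)z;q²)] = q^{-ν+1} z^{ν-1} I^{(2)}_{ν-1}((1-q²)qz;q²)` and
`(2/((1+q)z)) ∂_q [z^ν I^{(2)}_{-ν}((1-q²)z;q²)] = q^{-ν+1} z^{ν-1} I^{(2)}_{-ν+1}((1-q²)qz;q²)`. -/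
theorem stmt7 (q : ℝ) (hq0 : 0 < q) (hq1 : q < 1) (ν : ℝ)
    (h1 : ∀ m : ℤ, m < 0 → ν ≠ m) (h2 : ∀ m : ℤ, m < 0 → ν - 1 ≠ m)
    (h3 : ∀ m : ℤ, m < 0 → -ν ≠ m) (h4 : ∀ m : ℤ, m < 0 → -ν + 1 ≠ m)
    (z : ℝ) (hz0 : 0 < z) :
    (2 / ((1 + q) * z)) * qDeriv q (fun t => t ^ ν * I2 q ν t) z
        = q ^ (-ν + 1) * z ^ (ν - 1) * I2 q (ν - 1) (q * z) ∧
    (2 / ((1 + q) * z)) * qDeriv q (fun t => t ^ ν * I2 q (-ν) t) z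
        = q ^ (-ν + 1) * z ^ (ν - 1) * I2 q (-ν + 1) (q * z) := by
  have n1 : ∀ k : ℕ, ν + k + 1 ≠ 0 := by
    intro k h
    exact h1 (-(k + 1)) (by omega) (by push_cast; linarith)
  have n3 : ∀ k : ℕ, -ν + k + 1 ≠ 0 := by
    intro k h
    exact h3 (-(k + 1)) (by omega) (by push_cast; linarith)
  have n2 : ∀ k : ℕ, ν + k ≠ 0 := by
    intro k h
    exact h2 (-(k + 1)) (by omega) (by push_cast; linarith)
  have hp : 1 - q ^ 2 ≠ 0 := by nlinarith
  have hz2 : 0 < z / 2 := by positivity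
  have hzz : z = 2 * (z / 2) := by ring
  constructor
  · rw [(aux_lhs q ν ν z hq0 hq1 hz0 n1).2, aux_I2, ← tsum_mul_left]
    apply tsum_congr
    intro k
    unfold auxT
    obtain ⟨g1, g2⟩ := aux_gamma_step q (ν + k) hq0 hq1 (n2 k)
    rw [g2, show ν + ν + 2 * (k : ℝ) = 2 * (ν + k) by ring,
      show ν - 1 + (k : ℝ) + 1 = ν + k by ring, mul_div_assoc q z 2,
      Real.mul_rpow hq0.le hz2.le]
    have e1 : z ^ ν = z ^ (ν - 1) * z := by
      rw [← Real.rpow_add_one hz0.ne']; congr 1; ring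
    have e2 : (z / 2) ^ (ν + 2 * (k : ℝ)) = (z / 2) ^ (ν - 1 + 2 * (k : ℝ)) * (z / 2) := by
      rw [← Real.rpow_add_one hz2.ne']; congr 1; ring
    have e3 : q ^ (2 * (k : ℝ) * (ν + k)) =
        q ^ (-ν + 1) * q ^ (2 * (k : ℝ) * (ν - 1 + k)) * q ^ (ν - 1 + 2 * (k : ℝ)) := by
      rw [← Real.rpow_add hq0, ← Real.rpow_add hq0]; congr 1; ring
    rw [e1, e2, e3]
    generalize q ^ (2 * (ν + (k : ℝ))) = A at *
    generalize qGamma2 q (ν + k) = D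
    generalize qPochR (q ^ 2) (q ^ 2) k = E
    rw [← mul_div_assoc, ← mul_div_assoc]
    generalize (1 - q ^ 2) ^ k = F
    generalize (1 - A) = G at *
    generalize (1 - q ^ 2) = H at *
    rw [show E * (G / H * D) = (G / H) * (E * D) by ring, ← mul_div_assoc]
    rw [div_mul_eq_div_div]
    congr 1
    field_simp
  · obtain ⟨s, e⟩ := aux_lhs q ν (-ν) z hq0 hq1 hz0 n3
    rw [e, s.tsum_eq_zero_add, aux_I2, ← tsum_mul_left]
    simp only [Nat.cast_zero, mul_zero, add_neg_cancel, Real.rpow_zero, sub_self, zero_mul, zero_add, add_zero]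
    apply tsum_congr
    intro k
    unfold auxT
    rw [aux_poch_succ, show -ν + ((k + 1 : ℕ) : ℝ) + 1 = -ν + 1 + k + 1 by push_cast; ring,
      mul_div_assoc q z 2, Real.mul_rpow hq0.le hz2.le]
    have e0 : q ^ (2 * ((k + 1 : ℕ) : ℝ)) = q ^ 2 * (q ^ 2) ^ k := by
      rw [show 2 * ((k + 1 : ℕ) : ℝ) = ((2 * (k + 1) : ℕ) : ℝ) by push_cast; ring,
        Real.rpow_natCast, pow_mul, pow_succ]; ring
    have g1 : 1 - q ^ 2 * (q ^ 2) ^ k ≠ 0 := by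
      rw [← pow_succ', ← pow_mul]
      have := pow_lt_one₀ hq0.le hq1 (show 2 * (k + 1) ≠ 0 by omega)
      linarith
    have e1 : z ^ ν = z ^ (ν - 1) * z := by
      rw [← Real.rpow_add_one hz0.ne']; congr 1; ring
    have e2 : (z / 2) ^ (-ν + 2 * ((k + 1 : ℕ) : ℝ)) = (z / 2) ^ (-ν + 1 + 2 * (k : ℝ)) * (z / 2) := by
      rw [← Real.rpow_add_one hz2.ne']; congr 1; push_cast; ring
    have e3 : q ^ (2 * ((k + 1 : ℕ) : ℝ) * (-ν + ((k + 1 : ℕ) : ℝ))) =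
        q ^ (-ν + 1) * q ^ (2 * (k : ℝ) * (-ν + 1 + k)) * q ^ (-ν + 1 + 2 * (k : ℝ)) := by
      rw [← Real.rpow_add hq0, ← Real.rpow_add hq0]; congr 1; push_cast; ring
    rw [e0, e1, e2, e3, pow_succ (1 - q ^ 2)]
    generalize qGamma2 q (-ν + 1 + k + 1) = D
    generalize qPochR (q ^ 2) (q ^ 2) k = E
    rw [← mul_div_assoc, ← mul_div_assoc]
    generalize (1 - q ^ 2) ^ k = F
    generalize (1 - q ^ 2 * (q ^ 2) ^ k) = G at *
    generalize (1 - q ^ 2) = H at *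
    rw [show E * G * D = G * (E * D) by ring, ← mul_div_assoc]
    rw [div_mul_eq_div_div]
    congr 1
    field_simp
end

section
/- Let 0 < q < 1 be real, let ν be a real number that is not an integer, and let z be real with 0 < z < 2/(1−q²). Then the q-Wronskian of I^{(1)}_ν and I^{(1)}_{−ν} equals I^{(1)}_ν((1−q²)z;q²)·I^{(1)}_{−ν}((1−q²)qz;q²) − I^{(1)}_ν((1−q²)qz;q²)·I^{(1)}_{−ν}((1−q²)z;q²) = (q^{−ν}(1−q²) / (Γ_{q²}(ν) Γ_{q²}(1−ν))) · e_{q²}((1−q²)² z²/4). In particular this q-Wronskian never vanishes, so I^{(1)}_ν and I^{(1)}_{−ν} form a fundamental system of solutions of the difference equation [1 − q^{−2}(1−q²)²z²/4] f(q^{−1}z) − (q^{−ν}+q^{ν}) f(z) + f(qz) = 0. -/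
/-- The q²-exponential `e_{q²}(w) = 1/(w;q²)_∞`. -/
noncomputable def qExp2R (q w : ℝ) : ℝ := 1 / qPochInfR w (q ^ 2)

lemma aux_summ (a p : ℝ) (hp0 : 0 < p) (hp1 : p < 1) : Summable (fun j : ℕ => ‖-(a * p ^ j)‖) := by
  have := ((summable_geometric_of_lt_one hp0.le hp1).mul_left a).norm
  simpa using this

lemma aux_mult (a p : ℝ) (hp0 : 0 < p) (hp1 : p < 1) : Multipliable (fun j : ℕ => 1 - a * p ^ j) := by
  have := multipliable_one_add_of_summable (aux_summ a p hp0 hp1)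
  simpa [sub_eq_add_neg] using this

lemma aux_ne (a p : ℝ) (hp0 : 0 < p) (hp1 : p < 1) (h : ∀ j : ℕ, 1 - a * p ^ j ≠ 0) :
    qPochInfR a p ≠ 0 := by
  have := tprod_one_add_ne_zero_of_summable (f := fun j : ℕ => -(a * p ^ j))
    (fun i => by simpa [sub_eq_add_neg] using h i) (aux_summ a p hp0 hp1)
  simpa [qPochInfR, sub_eq_add_neg] using this

lemma aux_shift (a p : ℝ) (hp0 : 0 < p) (hp1 : p < 1) :
    qPochInfR a p = (1 - a) * qPochInfR (a * p) p := by
  have h : Multipliable (fun j : ℕ => 1 - a * p ^ (j + 1)) := by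
    have h0 := aux_mult (a * p) p hp0 hp1
    have e : (fun j : ℕ => 1 - a * p * p ^ j) = (fun j : ℕ => 1 - a * p ^ (j + 1)) := by
      funext j
      rw [pow_succ', mul_assoc]
    rwa [e] at h0
  have h2 := tprod_eq_zero_mul' (f := fun j : ℕ => 1 - a * p ^ j) h
  have h3 : ∏' j : ℕ, (1 - a * p ^ (j + 1)) = ∏' j : ℕ, (1 - a * p * p ^ j) :=
    tprod_congr (fun j => by rw [pow_succ', mul_assoc])
  rw [qPochInfR, qPochInfR, h2, h3, pow_zero, mul_one]

/-- coefficients -/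
noncomputable def Fc (a p : ℝ) (k : ℕ) : ℝ := (qPochR p p k * qPochR (a * p) p k)⁻¹

noncomputable def FF (a p x : ℝ) : ℝ := ∑' k : ℕ, Fc a p k * x ^ k

lemma aux_pp (p : ℝ) (hp0 : 0 < p) (hp1 : p < 1) (k : ℕ) : 1 - p * p ^ k ≠ 0 := by
  have : p ^ (k + 1) < 1 := pow_lt_one₀ hp0.le hp1 (by omega)
  rw [pow_succ'] at this
  linarith

lemma Fc_succ (a p : ℝ) (hp0 : 0 < p) (hp1 : p < 1) (ha : ∀ j : ℕ, 1 - a * p * p ^ j ≠ 0) (k : ℕ) :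
    Fc a p (k + 1) * ((1 - p * p ^ k) * (1 - a * p * p ^ k)) = Fc a p k := by
  have h1 := aux_pp p hp0 hp1 k
  have h2 := ha k
  unfold Fc qPochR
  rw [Finset.prod_range_succ, Finset.prod_range_succ, mul_mul_mul_comm, mul_inv,
    inv_mul_cancel_right₀ (mul_ne_zero h1 h2)]

lemma Fc_ne (a p : ℝ) (hp0 : 0 < p) (hp1 : p < 1) (ha : ∀ j : ℕ, 1 - a * p * p ^ j ≠ 0) (k : ℕ) :
    Fc a p k ≠ 0 := by
  unfold Fc qPochR
  refine inv_ne_zero (mul_ne_zero ?_ ?_)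
  · exact Finset.prod_ne_zero_iff.mpr (fun j _ => aux_pp p hp0 hp1 j)
  · exact Finset.prod_ne_zero_iff.mpr (fun j _ => ha j)

lemma FF_summable (a p : ℝ) (hp0 : 0 < p) (hp1 : p < 1) (ha : ∀ j : ℕ, 1 - a * p * p ^ j ≠ 0)
    (x : ℝ) (hx0 : 0 < x) (hx1 : x < 1) : Summable (fun k : ℕ => Fc a p k * x ^ k) := by
  refine summable_of_ratio_test_tendsto_lt_one hx1
    (Filter.Eventually.of_forall (fun k => mul_ne_zero (Fc_ne a p hp0 hp1 ha k) (by positivity))) ?_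
  have hp : Filter.Tendsto (fun k : ℕ => p ^ k) Filter.atTop (nhds 0) :=
    tendsto_pow_atTop_nhds_zero_of_lt_one hp0.le hp1
  have h1 : Filter.Tendsto (fun k : ℕ => ‖x / ((1 - p * p ^ k) * (1 - a * p * p ^ k))‖) Filter.atTop
      (nhds ‖x / ((1 - p * 0) * (1 - a * p * 0))‖) := by
    refine Filter.Tendsto.norm (Filter.Tendsto.div tendsto_const_nhds ?_ (by simp))
    exact (tendsto_const_nhds.sub (hp.const_mul _)).mul (tendsto_const_nhds.sub (hp.const_mul _))
  have h2 : ‖x / ((1 - p * 0) * (1 - a * p * 0))‖ = x := by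
    simp [abs_of_pos hx0]
  rw [h2] at h1
  refine h1.congr (fun k => ?_)
  rw [← norm_div]
  congr 1
  have e1 := aux_pp p hp0 hp1 k
  have e2 := ha k
  have e3 := Fc_ne a p hp0 hp1 ha (k + 1)
  rw [← Fc_succ a p hp0 hp1 ha k, pow_succ]
  field_simp

lemma FF_eq (a p : ℝ) (hp0 : 0 < p) (hp1 : p < 1) (ha : ∀ j : ℕ, 1 - a * p * p ^ j ≠ 0)
    (x : ℝ) (hx0 : 0 < x) (hx1 : x < 1) :
    (1 - x) * FF a p x = (1 + a) * FF a p (p * x) - a * FF a p (p * (p * x)) := by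
  have hpx : p * x < 1 := by nlinarith
  have hppx : p * (p * x) < 1 := by nlinarith [mul_pos hp0 hx0]
  have s0 := FF_summable a p hp0 hp1 ha x hx0 hx1
  have s1 := FF_summable a p hp0 hp1 ha (p * x) (by positivity) hpx
  have s2 := FF_summable a p hp0 hp1 ha (p * (p * x)) (by positivity) hppx
  have key : FF a p x - (1 + a) * FF a p (p * x) + a * FF a p (p * (p * x)) = x * FF a p x := by
    unfold FF
    rw [← tsum_mul_left, ← tsum_mul_left, ← tsum_mul_left,
      ← s0.tsum_sub (s1.mul_left _), ← (s0.sub (s1.mul_left _)).tsum_add (s2.mul_left _),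
      ((s0.sub (s1.mul_left _)).add (s2.mul_left _)).tsum_eq_zero_add]
    simp only [pow_zero, mul_one]
    rw [show Fc a p 0 - (1 + a) * Fc a p 0 + a * Fc a p 0 = 0 by ring, zero_add]
    refine tsum_congr (fun k => ?_)
    rw [← Fc_succ a p hp0 hp1 ha k]
    simp only [mul_pow, pow_succ]
    ring
  linarith

lemma FF_lim (a p : ℝ) (hp0 : 0 < p) (hp1 : p < 1) (ha : ∀ j : ℕ, 1 - a * p * p ^ j ≠ 0)
    (x : ℝ) (hx0 : 0 < x) (hx1 : x < 1) :
    Filter.Tendsto (fun n : ℕ => FF a p (p ^ n * x)) Filter.atTop (nhds 1) := by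
  have hs := (FF_summable a p hp0 hp1 ha x hx0 hx1).norm
  have hp : Filter.Tendsto (fun k : ℕ => p ^ k) Filter.atTop (nhds 0) :=
    tendsto_pow_atTop_nhds_zero_of_lt_one hp0.le hp1
  have := tendsto_tsum_of_dominated_convergence (𝓕 := Filter.atTop)
    (f := fun (n : ℕ) (k : ℕ) => Fc a p k * (p ^ n * x) ^ k)
    (g := fun k : ℕ => Fc a p k * (0 * x) ^ k) hs
    (fun k => ((hp.mul_const x).pow k).const_mul _)
    (Filter.Eventually.of_forall (fun n k => by
      rw [norm_mul, norm_mul]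
      refine mul_le_mul_of_nonneg_left ?_ (norm_nonneg _)
      rw [norm_pow, norm_pow]
      refine pow_le_pow_left₀ (norm_nonneg _) ?_ _
      rw [norm_mul, Real.norm_of_nonneg (by positivity : 0 ≤ p ^ n)]
      exact mul_le_of_le_one_left (norm_nonneg _) (pow_le_one₀ hp0.le hp1.le)))
  have e : ∑' k : ℕ, Fc a p k * (0 * x) ^ k = 1 := by
    rw [tsum_eq_single 0]
    · simp [Fc, qPochR]
    · intro k hk
      simp [hk]
  rw [e] at this
  exact this

lemma G_eq (a b p : ℝ) (hab : a * b = 1) (hp0 : 0 < p) (hp1 : p < 1)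
    (ha : ∀ j : ℕ, 1 - a * p * p ^ j ≠ 0) (hb : ∀ j : ℕ, 1 - b * p * p ^ j ≠ 0)
    (x : ℝ) (hx0 : 0 < x) (hx1 : x < 1) :
    qPochInfR x p * (FF a p x * FF b p (p * x) - a * FF a p (p * x) * FF b p x) = 1 - a := by
  set G : ℝ → ℝ := fun y => FF a p y * FF b p (p * y) - a * FF a p (p * y) * FF b p y with hG
  have step : ∀ y, 0 < y → y < 1 → (1 - y) * G y = G (p * y) := by
    intro y h0 h1
    have ea := FF_eq a p hp0 hp1 ha y h0 h1
    have eb := FF_eq b p hp0 hp1 hb y h0 h1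
    simp only [hG]
    linear_combination FF b p (p * y) * ea - a * FF a p (p * y) * eb +
      (FF a p (p * y) * FF b p (p * (p * y)) - FF a p (p * y) * FF b p (p * y)) * hab
  have it : ∀ n : ℕ, (∏ j ∈ Finset.range n, (1 - x * p ^ j)) * G x = G (p ^ n * x) := by
    intro n
    induction n with
    | zero => simp
    | succ n ih =>
      have h0 : 0 < p ^ n * x := by positivity
      have h1 : p ^ n * x < 1 :=
        lt_of_le_of_lt (mul_le_of_le_one_left hx0.le (pow_le_one₀ hp0.le hp1.le)) hx1
      have := step _ h0 h1
      rw [Finset.prod_range_succ, pow_succ', mul_assoc p, ← this, ← ih]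
      ring
  have l1 := ((aux_mult x p hp0 hp1).hasProd.tendsto_prod_nat).mul_const (G x)
  have fa := FF_lim a p hp0 hp1 ha x hx0 hx1
  have fb := FF_lim b p hp0 hp1 hb x hx0 hx1
  have fa' := (Filter.tendsto_add_atTop_iff_nat 1).mpr fa
  have fb' := (Filter.tendsto_add_atTop_iff_nat 1).mpr fb
  have l2 := (fa.mul fb').sub ((fa'.const_mul a).mul fb)
  have l3 := tendsto_nhds_unique l1 (l2.congr (fun n => by
    rw [it]
    simp only [hG, pow_succ', mul_assoc]))
  simpa [qPochInfR] using l3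

lemma exp_shift (q : ℝ) (hq0 : 0 < q) (s : ℝ) (j : ℕ) :
    Real.exp (2 * s * Real.log q) * (q ^ 2) ^ j = Real.exp (2 * (s + j) * Real.log q) := by
  have : (q ^ 2) ^ j = Real.exp (2 * j * Real.log q) := by
    rw [← pow_mul, ← Real.exp_log (pow_pos hq0 (2 * j)), Real.log_pow]
    push_cast
    rfl
  rw [this, ← Real.exp_add]
  ring_nf

lemma exp_ne (q : ℝ) (hq0 : 0 < q) (hq1 : q < 1) (s : ℝ) (hs : s ≠ 0) :
    1 - Real.exp (2 * s * Real.log q) ≠ 0 := by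
  rw [sub_ne_zero, ne_comm, Ne, Real.exp_eq_one_iff]
  have := Real.log_neg hq0 hq1
  simp [hs, this.ne]

lemma poch_ne (q : ℝ) (hq0 : 0 < q) (hq1 : q < 1) (s : ℝ) (hs : ∀ m : ℤ, s ≠ m) (j : ℕ) :
    1 - Real.exp (2 * s * Real.log q) * (q ^ 2) ^ j ≠ 0 := by
  rw [exp_shift q hq0]
  refine exp_ne q hq0 hq1 _ (fun h => hs (-j) ?_)
  push_cast
  linarith

lemma gamma_ne (q : ℝ) (hq0 : 0 < q) (hq1 : q < 1) (s : ℝ) (hs : ∀ m : ℤ, s ≠ m) :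
    qGamma2 q s ≠ 0 := by
  have hp0 : 0 < q ^ 2 := by positivity
  have hp1 : q ^ 2 < 1 := by nlinarith
  unfold qGamma2
  refine mul_ne_zero (div_ne_zero ?_ ?_) ?_
  · exact aux_ne _ _ hp0 hp1 (aux_pp _ hp0 hp1)
  · exact aux_ne _ _ hp0 hp1 (poch_ne q hq0 hq1 s hs)
  · exact (Real.rpow_pos_of_pos (by linarith) _).ne'

lemma gamma_succ (q : ℝ) (hq0 : 0 < q) (hq1 : q < 1) (s : ℝ) (hs : ∀ m : ℤ, s ≠ m) :
    qGamma2 q (s + 1) = (1 - Real.exp (2 * s * Real.log q)) / (1 - q ^ 2) * qGamma2 q s := by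
  have hp0 : 0 < q ^ 2 := by positivity
  have hp1 : q ^ 2 < 1 := by nlinarith
  have h1 : (1 - q ^ 2 : ℝ) ≠ 0 := by linarith
  have h2 := exp_ne q hq0 hq1 s (by simpa using hs 0)
  have h3 := aux_ne _ _ hp0 hp1 (poch_ne q hq0 hq1 s hs)
  unfold qGamma2
  have e := exp_shift q hq0 s 1
  rw [pow_one, Nat.cast_one] at e
  rw [aux_shift (Real.exp (2 * s * Real.log q)) _ hp0 hp1, e] at h3 ⊢
  have h4 := right_ne_zero_of_mul h3
  rw [show 1 - s = (1 - (s + 1)) + 1 by ring, Real.rpow_add_one h1]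
  field_simp
  
lemma gamma_add (q : ℝ) (hq0 : 0 < q) (hq1 : q < 1) (s : ℝ) (hs : ∀ m : ℤ, s ≠ m) (k : ℕ) :
    qGamma2 q (s + k + 1) * (1 - q ^ 2) ^ k =
      qPochR (Real.exp (2 * s * Real.log q) * q ^ 2) (q ^ 2) k * qGamma2 q (s + 1) := by
  have hp1 : q ^ 2 < 1 := by nlinarith
  have h1 : (1 - q ^ 2 : ℝ) ≠ 0 := by linarith
  induction k with
  | zero => simp [qPochR]
  | succ k ih =>
    have hs' : ∀ m : ℤ, s + k + 1 ≠ m := fun m h => hs (m - k - 1) (by push_cast; linarith)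
    unfold qPochR at ih ⊢
    rw [Finset.prod_range_succ, mul_right_comm, ← ih]
    push_cast
    rw [← add_assoc s, gamma_succ q hq0 hq1 _ hs', mul_assoc _ (q ^ 2), ← pow_succ', exp_shift q hq0]
    push_cast
    rw [← add_assoc s, pow_succ (1 - q ^ 2) k]
    generalize (1 - q ^ 2) ^ k = u
    field_simp

lemma I1_eq (q : ℝ) (hq0 : 0 < q) (hq1 : q < 1) (s : ℝ) (hs : ∀ m : ℤ, s ≠ m) (z : ℝ) (hz : 0 < z) :
    I1 q s z = (z / 2) ^ s / qGamma2 q (s + 1) *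
      FF (Real.exp (2 * s * Real.log q)) (q ^ 2) ((1 - q ^ 2) ^ 2 * z ^ 2 / 4) := by
  have hp1 : q ^ 2 < 1 := by nlinarith
  have h1 : (1 - q ^ 2 : ℝ) ≠ 0 := by linarith
  unfold I1 FF
  rw [← tsum_mul_left]
  refine tsum_congr (fun k => ?_)
  have hg := gamma_add q hq0 hq1 s hs k
  have hs' : ∀ m : ℤ, s + k + 1 ≠ m := fun m h => hs (m - k - 1) (by push_cast; linarith)
  have hs'' : ∀ m : ℤ, s + 1 ≠ m := fun m h => hs (m - 1) (by push_cast; linarith)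
  have g1 := gamma_ne q hq0 hq1 _ hs'
  have g2 := gamma_ne q hq0 hq1 _ hs''
  have e : (z / 2) ^ (s + 2 * (k : ℝ)) = (z / 2) ^ s * (z ^ 2 / 4) ^ k := by
    rw [Real.rpow_add (by positivity), Real.rpow_mul (by positivity), Real.rpow_natCast]
    congr 2
    norm_num
    ring
  have hP : qPochR (Real.exp (2 * s * Real.log q) * q ^ 2) (q ^ 2) k =
      qGamma2 q (s + k + 1) * (1 - q ^ 2) ^ k / qGamma2 q (s + 1) := by
    rw [hg]; field_simp
  rw [e, Fc, hP, mul_div_assoc ((1 - q ^ 2) ^ 2), mul_pow ((1 - q ^ 2) ^ 2), ← pow_mul, mul_comm 2 k, pow_mul]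
  have : qPochR (q ^ 2) (q ^ 2) k ≠ 0 :=
    Finset.prod_ne_zero_iff.mpr (fun j _ => aux_pp _ (by positivity) hp1 j)
  field_simp

/-- The q-Wronskian (3.13) of `I^{(1)}_ν` and `I^{(1)}_{-ν}`:
`I^{(1)}_ν((1-q²)z;q²) I^{(1)}_{-ν}((1-q²)qz;q²) - I^{(1)}_ν((1-q²)qz;q²) I^{(1)}_{-ν}((1-q²)z;q²)
  = (q^{-ν}(1-q²)/(Γ_{q²}(ν)Γ_{q²}(1-ν))) e_{q²}((1-q²)²z²/4)`,
and this q-Wronskian never vanishes (so `I^{(1)}_{±ν}` form a fundamental system of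
solutions of the q-difference equation (3.11)). -/
theorem stmt11 (q : ℝ) (hq0 : 0 < q) (hq1 : q < 1) (ν : ℝ)
    (hν : ∀ m : ℤ, ν ≠ m)
    (z : ℝ) (hz0 : 0 < z) (hz : z < 2 / (1 - q ^ 2)) :
    I1 q ν z * I1 q (-ν) (q * z) - I1 q ν (q * z) * I1 q (-ν) z
        = q ^ (-ν) * (1 - q ^ 2) / (qGamma2 q ν * qGamma2 q (1 - ν)) *
          qExp2R q ((1 - q ^ 2) ^ 2 * z ^ 2 / 4) ∧
    I1 q ν z * I1 q (-ν) (q * z) - I1 q ν (q * z) * I1 q (-ν) z ≠ 0 := by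
  have hp0 : 0 < q ^ 2 := by positivity
  have hp1 : q ^ 2 < 1 := by nlinarith
  have h1 : (1 - q ^ 2 : ℝ) ≠ 0 := by linarith
  have h1' : 0 < 1 - q ^ 2 := by linarith
  have hν' : ∀ m : ℤ, -ν ≠ m := fun m h => hν (-m) (by push_cast; linarith)
  have hν1 : ∀ m : ℤ, 1 - ν ≠ m := fun m h => hν (1 - m) (by push_cast; linarith)
  set x := (1 - q ^ 2) ^ 2 * z ^ 2 / 4 with hx
  have hx0 : 0 < x := by positivity
  have hx1 : x < 1 := by
    rw [lt_div_iff₀ h1'] at hz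
    have : 0 < z * (1 - q ^ 2) := by positivity
    rw [hx]
    nlinarith
  set a := Real.exp (2 * ν * Real.log q) with ha
  set b := Real.exp (2 * (-ν) * Real.log q) with hb
  have hab : a * b = 1 := by
    rw [ha, hb, ← Real.exp_add, ← Real.exp_zero]
    ring_nf
  have han : ∀ j : ℕ, 1 - a * q ^ 2 * (q ^ 2) ^ j ≠ 0 := fun j => by
    have := poch_ne q hq0 hq1 ν hν (j + 1)
    rwa [pow_succ', ← mul_assoc] at this
  have hbn : ∀ j : ℕ, 1 - b * q ^ 2 * (q ^ 2) ^ j ≠ 0 := fun j => by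
    have := poch_ne q hq0 hq1 (-ν) hν' (j + 1)
    rwa [pow_succ', ← mul_assoc] at this
  have hG := G_eq a b (q ^ 2) hab hp0 hp1 han hbn x hx0 hx1
  have ha1 : 1 - a ≠ 0 := exp_ne q hq0 hq1 ν (by simpa using hν 0)
  have hE : qPochInfR x (q ^ 2) ≠ 0 := left_ne_zero_of_mul (hG ▸ ha1)
  have hqz : 0 < q * z := by positivity
  have hxq : (1 - q ^ 2) ^ 2 * (q * z) ^ 2 / 4 = q ^ 2 * x := by rw [hx]; ring
  have g1 := gamma_ne q hq0 hq1 ν hν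
  have g2 := gamma_ne q hq0 hq1 (1 - ν) hν1
  have hqν : 0 < q ^ (-ν) := Real.rpow_pos_of_pos hq0 _
  have haq : q ^ ν = a * q ^ (-ν) := by
    rw [Real.rpow_def_of_pos hq0, Real.rpow_def_of_pos hq0, ha, ← Real.exp_add]
    ring_nf
  have hzz : (z / 2) ^ (-ν) = ((z / 2) ^ ν)⁻¹ := Real.rpow_neg (by positivity) _
  have hz2 : (z / 2) ^ ν ≠ 0 := (Real.rpow_pos_of_pos (by positivity) _).ne'
  have main : I1 q ν z * I1 q (-ν) (q * z) - I1 q ν (q * z) * I1 q (-ν) z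
        = q ^ (-ν) * (1 - q ^ 2) / (qGamma2 q ν * qGamma2 q (1 - ν)) * qExp2R q x := by
    rw [I1_eq q hq0 hq1 ν hν z hz0, I1_eq q hq0 hq1 ν hν _ hqz, I1_eq q hq0 hq1 _ hν' z hz0,
      I1_eq q hq0 hq1 _ hν' _ hqz, hxq, ← hx, ← ha, ← hb, mul_div_assoc q z 2,
      Real.mul_rpow hq0.le (by positivity), Real.mul_rpow hq0.le (by positivity), hzz, haq,
      gamma_succ q hq0 hq1 ν hν, ← ha, neg_add_eq_sub ν 1, qExp2R]
    rw [mul_comm, ← eq_div_iff hE] at hG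
    have : (1 : ℝ) / qPochInfR x (q ^ 2) = (FF a (q ^ 2) x * FF b (q ^ 2) (q ^ 2 * x) -
      a * FF a (q ^ 2) (q ^ 2 * x) * FF b (q ^ 2) x) / (1 - a) := by
      rw [hG]; field_simp
    rw [this]
    field_simp
  refine ⟨main, ?_⟩
  rw [main, qExp2R]
  exact mul_ne_zero (div_ne_zero (mul_ne_zero hqν.ne' h1) (mul_ne_zero g1 g2)) (one_div_ne_zero hE)
end
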